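/- Induction step of the reduction to Pfister forms. Let F be a field of characteristic ≠ 2, let b_1, …, b_t ∈ F be units, and let π = ⟨⟨b_1, …, b_t⟩⟩ be the t-fold Pfister form of rank 2^t. Suppose π decomposes as an orthogonal sum π ≅ u ⊥ s with u a quadratic form on F^{d₁} and s a quadratic form on F^{d₂}, d₁ + d₂ = 2^t. Let a ∈ F be a unit, let p := s ⊥ ⟨a⟩ be the quadratic form on F^{r}, r = d₂ + 1, given by (w, t) ↦ s(w) + a·t², and let p(X) be the generic value of p in F(X_1, …, X_r) = FractionRing (MvPolynomial (Fin r) F). Let L/F be a field extension such that π is anisotropic over L. Then the form u ⊥ ⟨−a⟩, given by (v, t) ↦ u(v) − a·t², is isotropic over L if and only if the (t+1)-fold Pfister form ⟨⟨b_1, …, b_t, p(X)⟩⟩ is isotropic over L(X_1, …, X_r) (with b_1, …, b_t and p(X) transported along the canonical embedding F(X_1, …, X_r) → L(X_1, …, X_r)). -/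

import Mathlib

noncomputable section

open scoped BigOperators

/-- A quadratic form is *isotropic* if it vanishes on some nonzero vector. -/
def QuadraticMap.IsIsotropic {R M : Type*} [CommSemiring R] [AddCommMonoid M] [Module R M]
    (q : QuadraticForm R M) : Prop :=
  ∃ v, v ≠ 0 ∧ q v = 0

/-- `p` is a subform of `q` -/
def QuadraticMap.IsSubform {R M₁ M₂ : Type*} [CommSemiring R] [AddCommMonoid M₁]
    [AddCommMonoid M₂] [Module R M₁] [Module R M₂]
    (p : QuadraticForm R M₁) (q : QuadraticForm R M₂) : Prop :=
  ∃ f : M₁ →ₗ[R] M₂, Function.Injective f ∧ ∀ v, q (f v) = p v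

/-- Base change of a quadratic form on `k^n` along a ring homomorphism `f : k →+* E`:
the quadratic form on `E^n` whose values on the standard basis vectors, and whose polar
values on pairs of standard basis vectors, are the images under `f` of those of `q`. -/
def QuadraticForm.mapAlong {k E : Type*} [CommRing k] [CommRing E] (f : k →+* E) {n : ℕ}
    (q : QuadraticForm k (Fin n → k)) : QuadraticForm E (Fin n → E) :=
  Matrix.toQuadraticMap' (Matrix.of fun i j =>
    if i = j then f (q (Pi.single i 1))
    else if i < j then f (QuadraticMap.polar ⇑q (Pi.single i 1) (Pi.single j 1)) else 0)

/-- The `n`-fold Pfister form `⟨⟨a_1, …, a_n⟩⟩`: the diagonal quadratic form of rank `2^n`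
whose diagonal entries, indexed by the subsets `S ⊆ {1, …, n}`, are `∏_{i ∈ S} (-a_i)`. -/
def PfisterForm {F : Type*} [Field F] {n : ℕ} (a : Fin n → F) :
    QuadraticForm F (Finset (Fin n) → F) :=
  QuadraticMap.weightedSumSquares F (fun S : Finset (Fin n) => ∏ i ∈ S, (-a i))

/-- The canonical ring embedding of `F` into `F(x_1, …, x_m)`. -/
def toFrac (F : Type*) [Field F] (m : ℕ) : F →+* FractionRing (MvPolynomial (Fin m) F) :=
  (algebraMap (MvPolynomial (Fin m) F) (FractionRing (MvPolynomial (Fin m) F))).comp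
    MvPolynomial.C

/-- The canonical embedding `F(x_1, …, x_m) → L(x_1, …, x_m)` induced by `F → L`. -/
def transMap (F L : Type*) [Field F] [Field L] [Algebra F L] (m : ℕ) :
    FractionRing (MvPolynomial (Fin m) F) →+* FractionRing (MvPolynomial (Fin m) L) :=
  IsFractionRing.lift (g := (algebraMap (MvPolynomial (Fin m) L)
      (FractionRing (MvPolynomial (Fin m) L))).comp (MvPolynomial.map (algebraMap F L)))
    (((IsFractionRing.injective (MvPolynomial (Fin m) L)
        (FractionRing (MvPolynomial (Fin m) L))).comp
      (MvPolynomial.map_injective _ (algebraMap F L).injective)))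

/-- The generic value `p(X)` of a quadratic form `p` on `k^n`: the value of the base change
of `p` to `k(X_1, …, X_n)` at the vector of indeterminates. -/
def genericValue {k : Type*} [Field k] {n : ℕ} (p : QuadraticForm k (Fin n → k)) :
    FractionRing (MvPolynomial (Fin n) k) :=
  (p.mapAlong (toFrac k n)) fun i =>
    algebraMap (MvPolynomial (Fin n) k) (FractionRing (MvPolynomial (Fin n) k))
      (MvPolynomial.X i)

/-- `E` is a finite extension of odd degree of `F`, via the ring homomorphism `f`. -/
def IsOddFiniteExt (F E : Type*) [Field F] [Field E] (f : F →+* E) : Prop :=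
  letI : Algebra F E := f.toAlgebra
  FiniteDimensional F E ∧ Odd (Module.finrank F E)

universe u

lemma natDegree_le_of_weighted {R ι : Type*} [CommRing R] [IsDomain R] [Fintype ι] {w : ι → R}
    (hw : ∀ x : ι → R, ∑ i, w i * x i ^ 2 = 0 → x = 0) (x : ι → Polynomial R) {N : ℕ}
    (hx : (∑ i, Polynomial.C (w i) * x i ^ 2).natDegree ≤ 2 * N) (i : ι) :
    (x i).natDegree ≤ N := by
  set M := Finset.univ.sup fun i => (x i).natDegree with hM
  have hle : ∀ i, (x i).natDegree ≤ M := fun i =>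
    Finset.le_sup (f := fun i => (x i).natDegree) (Finset.mem_univ i)
  by_contra! hlt
  have hNM : N < M := hlt.trans_le (hle i)
  have h0 : (∑ i, Polynomial.C (w i) * x i ^ 2).coeff (2 * M) = 0 :=
    Polynomial.coeff_eq_zero_of_natDegree_lt (by omega)
  simp only [Polynomial.finsetSum_coeff, Polynomial.coeff_C_mul] at h0
  have h1 := hw (fun i => (x i).coeff M) (by
    rw [← h0]
    refine Finset.sum_congr rfl fun i _ => ?_
    rw [Polynomial.coeff_pow_of_natDegree_le (hle i)])
  obtain ⟨j, -, hj⟩ := Finset.exists_mem_eq_sup Finset.univ ⟨i, Finset.mem_univ i⟩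
    fun i => (x i).natDegree
  rw [← hM] at hj
  have h2 := congrFun h1 j
  simp only [hj, Pi.zero_apply, Polynomial.coeff_natDegree, Polynomial.leadingCoeff_eq_zero] at h2
  simp [h2] at hj
  omega

lemma Polynomial.weighted_anisotropic {R ι : Type*} [CommRing R] [IsDomain R] [Fintype ι]
    {w : ι → R} (hw : ∀ x : ι → R, ∑ i, w i * x i ^ 2 = 0 → x = 0) (x : ι → Polynomial R)
    (hx : ∑ i, Polynomial.C (w i) * x i ^ 2 = 0) : x = 0 := by
  have hd := natDegree_le_of_weighted hw x (N := 0) (by simp [hx])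
  have hc : ∀ i, x i = Polynomial.C ((x i).coeff 0) := fun i =>
    Polynomial.eq_C_of_natDegree_le_zero (hd i)
  have h := hw (fun i => (x i).coeff 0) (by
    apply Polynomial.C_injective
    rw [map_zero, ← hx, map_sum]
    refine Finset.sum_congr rfl fun i _ => ?_
    conv_rhs => rw [hc i]
    simp)
  funext i
  rw [hc i, congrFun h i]
  simp

lemma MvPolynomial.weighted_anisotropic {R ι : Type*} [CommRing R] [IsDomain R] [Fintype ι]
    {w : ι → R} (hw : ∀ x : ι → R, ∑ i, w i * x i ^ 2 = 0 → x = 0) (n : ℕ)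
    (x : ι → MvPolynomial (Fin n) R) (hx : ∑ i, MvPolynomial.C (w i) * x i ^ 2 = 0) : x = 0 := by
  induction n with
  | zero =>
    have h := hw (fun i => MvPolynomial.isEmptyRingEquiv R (Fin 0) (x i)) (by
      have h0 := congrArg (MvPolynomial.isEmptyRingEquiv R (Fin 0)) hx
      rw [map_sum, map_zero] at h0
      rw [← h0]
      refine Finset.sum_congr rfl fun i _ => ?_
      rw [map_mul, map_pow]
      congr 1
      exact ((MvPolynomial.isEmptyRingEquiv R (Fin 0)).apply_symm_apply (w i)).symm)
    funext i
    exact (map_eq_zero_iff _ (MvPolynomial.isEmptyRingEquiv R (Fin 0)).injective).1 (congrFun h i)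
  | succ n ih =>
    have h := Polynomial.weighted_anisotropic (w := fun i => (MvPolynomial.C (w i))) ih
      (fun i => MvPolynomial.finSuccEquiv R n (x i)) (by
      have := congrArg (MvPolynomial.finSuccEquiv R n) hx
      simpa [MvPolynomial.finSuccEquiv_apply] using this)
    funext i
    simpa using congrFun h i

lemma exists_common_denominator {R K ι : Type*} [CommRing R] [IsDomain R] [Field K] [Algebra R K]
    [IsFractionRing R K] [Fintype ι] (x : ι → K) :
    ∃ (g : R) (y : ι → R), g ≠ 0 ∧ ∀ i, algebraMap R K (y i) = algebraMap R K g * x i := by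
  obtain ⟨g, hg⟩ := IsLocalization.exist_integer_multiples_of_finite (nonZeroDivisors R) x
  choose y hy using hg
  exact ⟨g, y, nonZeroDivisors.coe_ne_zero g, fun i => by rw [hy, Algebra.smul_def]⟩

lemma IsFractionRing.weighted_anisotropic {R K ι : Type*} [CommRing R] [IsDomain R] [Field K]
    [Algebra R K] [IsFractionRing R K] [Fintype ι]
    {w : ι → R} (hw : ∀ x : ι → R, ∑ i, w i * x i ^ 2 = 0 → x = 0)
    (x : ι → K) (hx : ∑ i, algebraMap R K (w i) * x i ^ 2 = 0) : x = 0 := by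
  obtain ⟨g, y, hg, hy⟩ := exists_common_denominator (R := R) x
  have hinj := IsFractionRing.injective R K
  have h := hw y (by
    apply hinj
    simp only [map_sum, map_mul, map_pow, hy, map_zero]
    rw [← mul_zero ((algebraMap R K g) ^ 2), ← hx, Finset.mul_sum]
    exact Finset.sum_congr rfl fun i _ => by ring)
  funext i
  have := hy i
  rw [h] at this
  simpa [hg, hinj] using this.symm

/-- **Cassels-Pfister theorem**: a polynomial represented over `K(X)` by an anisotropic diagonal
form over `K` is already represented over `K[X]`. -/
lemma cassels_pfister {K ι : Type*} [Field K] [Fintype ι] {w : ι → K}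
    (hw : ∀ x : ι → K, ∑ i, w i * x i ^ 2 = 0 → x = 0) (f : Polynomial K) :
    ∀ (n : ℕ) (g : Polynomial K) (x : ι → Polynomial K), g.natDegree = n → g ≠ 0 →
      ∑ i, Polynomial.C (w i) * x i ^ 2 = f * g ^ 2 →
      ∃ y : ι → Polynomial K, ∑ i, Polynomial.C (w i) * y i ^ 2 = f := by
  intro n
  induction n using Nat.strong_induction_on with
  | _ n ih =>
  intro g x hgn hg hx
  set q : ι → Polynomial K := fun i => x i / g with hq
  set r : ι → Polynomial K := fun i => x i % g with hr
  have hxqr : ∀ i, x i = g * q i + r i := fun i => (EuclideanDomain.div_add_mod (x i) g).symm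
  set Q := ∑ i, Polynomial.C (w i) * q i ^ 2 with hQ
  set B := ∑ i, Polynomial.C (w i) * (q i * r i) with hB
  set S := ∑ i, Polynomial.C (w i) * r i ^ 2 with hS
  have expand : ∀ α β : Polynomial K,
      ∑ i, Polynomial.C (w i) * (α * q i + β * r i) ^ 2 = α ^ 2 * Q + 2 * α * β * B + β ^ 2 * S := by
    intro α β
    simp only [hQ, hB, hS, Finset.mul_sum, ← Finset.sum_add_distrib]
    exact Finset.sum_congr rfl fun i _ => by ring
  have hrel : g ^ 2 * Q + 2 * g * B + S = f * g ^ 2 := by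
    have h1 := expand g 1
    simp only [one_mul, ← hxqr, hx] at h1
    linear_combination -h1
  by_cases hr0 : r = 0
  · refine ⟨q, ?_⟩
    have hB0 : B = 0 := by simp [hB, hr0]
    have hS0 : S = 0 := by simp [hS, hr0]
    rw [hB0, hS0] at hrel
    exact mul_left_cancel₀ (pow_ne_zero 2 hg) (by rw [← hQ]; linear_combination hrel)
  set h := f * g - g * Q - 2 * B with hh
  have hSgh : S = g * h := by rw [hh]; linear_combination hrel
  have hS0 : S ≠ 0 := fun h0 => hr0 (Polynomial.weighted_anisotropic hw r h0)
  have hh0 : h ≠ 0 := by rintro h0; exact hS0 (by rw [hSgh, h0, mul_zero])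
  have hn : n ≠ 0 := by
    rintro rfl
    refine hr0 (funext fun i => ?_)
    obtain ⟨γ, hγ⟩ := Polynomial.natDegree_eq_zero.1 hgn
    have hγ0 : γ ≠ 0 := by rintro rfl; exact hg (by rw [← hγ, map_zero])
    exact EuclideanDomain.mod_eq_zero.2
      ((hγ ▸ Polynomial.isUnit_C.2 hγ0.isUnit : IsUnit g).dvd)
  have hSdeg : S.natDegree ≤ 2 * (n - 1) := by
    refine Polynomial.natDegree_sum_le_of_forall_le _ _ fun i _ => ?_
    refine (Polynomial.natDegree_C_mul_le _ _).trans (Polynomial.natDegree_pow_le.trans ?_)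
    have := Polynomial.natDegree_mod_lt (x i) (q := g) (by omega)
    have : (r i).natDegree ≤ n - 1 := by simp only [hr]; omega
    omega
  have hhdeg : h.natDegree < n := by
    rw [hSgh, Polynomial.natDegree_mul hg hh0] at hSdeg
    omega
  refine ih _ hhdeg h (fun i => h * q i + (Q - f) * r i) rfl hh0 ?_
  rw [expand, hSgh, hh]
  ring

lemma second_representation {K ι : Type*} [Field K] (h2 : (2 : K) ≠ 0) [Fintype ι] {w : ι → K}
    (hw : ∀ x : ι → K, ∑ i, w i * x i ^ 2 = 0 → x = 0) (i₀ : ι) (d : K)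
    (g : Polynomial K) (x : ι → Polynomial K) (hg : g ≠ 0)
    (hx : ∑ i, Polynomial.C (w i) * x i ^ 2 =
      (Polynomial.C (w i₀) * Polynomial.X ^ 2 + Polynomial.C d) * g ^ 2) :
    ∃ y : ι → K, y i₀ = 0 ∧ ∑ i, w i * y i ^ 2 = d := by
  classical
  obtain ⟨y, hy⟩ := cassels_pfister hw _ _ g x rfl hg hx
  have hdeg := natDegree_le_of_weighted hw y (N := 1) (by
    rw [hy]; compute_degree)
  obtain ⟨α, β, hαβ⟩ := Polynomial.exists_eq_X_add_C_of_natDegree_le_one (hdeg i₀)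
  obtain ⟨z, hz⟩ : ∃ z : K, (y i₀).eval z ^ 2 = z ^ 2 := by
    simp only [hαβ, Polynomial.eval_add, Polynomial.eval_mul, Polynomial.eval_C, Polynomial.eval_X]
    by_cases hα : α = 1
    · refine ⟨-β / 2, ?_⟩
      subst hα; field_simp; ring
    · refine ⟨β / (1 - α), ?_⟩
      have : 1 - α ≠ 0 := sub_ne_zero.2 (Ne.symm hα)
      field_simp; ring
  refine ⟨Function.update (fun i => (y i).eval z) i₀ 0, by simp, ?_⟩
  have he := congrArg (Polynomial.eval z) hy
  simp only [Polynomial.eval_finsetSum, Polynomial.eval_mul, Polynomial.eval_C,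
    Polynomial.eval_pow, Polynomial.eval_add, Polynomial.eval_X] at he
  rw [Fintype.sum_eq_add_sum_compl i₀] at he ⊢
  rw [hz] at he
  simp only [Function.update_self]
  rw [← add_left_cancel he, zero_pow two_ne_zero, mul_zero, zero_add]
  refine Finset.sum_congr rfl fun i hi => ?_
  rw [Function.update_of_ne (by simpa using hi)]

lemma weighted_descent {L ι : Type*} [Field L] (h2 : (2 : L) ≠ 0) [Fintype ι] (w : ι → L) (a : L)
    (n : ℕ) : ∀ (c : Fin n → L)
    (_ : ∀ x : ι ⊕ Fin n → L, ∑ i, Sum.elim w c i * x i ^ 2 = 0 → x = 0)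
    (x : ι ⊕ Fin n → MvPolynomial (Fin (n + 1)) L) (g : MvPolynomial (Fin (n + 1)) L) (_ : g ≠ 0)
    (_ : ∑ i, MvPolynomial.C (Sum.elim w c i) * x i ^ 2 =
      (∑ j, MvPolynomial.C (c j) * MvPolynomial.X j.castSucc ^ 2 +
        MvPolynomial.C a * MvPolynomial.X (Fin.last n) ^ 2) * g ^ 2),
    ∃ (y : ι → L) (τ : L), τ ≠ 0 ∧ ∑ i, w i * y i ^ 2 = a * τ ^ 2 := by
  induction n with
  | zero =>
    intro c hw x g hg hx
    by_contra! hcon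
    have hanis : ∀ y : Option ι → L, ∑ i, (fun o : Option ι => o.elim (-a) w) i * y i ^ 2 = 0 →
        y = 0 := by
      intro y hy
      simp only [Fintype.sum_option, Option.elim] at hy
      by_cases hτ : y none = 0
      · have := hw (Sum.elim (fun i => y (some i)) 0) (by
          simpa [hτ] using hy)
        funext o
        cases o with
        | none => exact hτ
        | some i => exact congrFun this (Sum.inl i)
      · exact absurd (by linear_combination hy) (hcon (fun i => y (some i)) _ hτ)
    have h := MvPolynomial.weighted_anisotropic hanis 1
      (fun o => o.elim (MvPolynomial.X 0 * g) fun i => x (Sum.inl i)) (by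
        simp only [Fintype.sum_option, Option.elim]
        simp at hx
        rw [hx, map_neg]
        ring)
    simpa [hg] using congrFun h none
  | succ n ih =>
    intro c hw x g hg hx
    have hwR := MvPolynomial.weighted_anisotropic hw (n + 1)
    have hwK := IsFractionRing.weighted_anisotropic
      (K := FractionRing (MvPolynomial (Fin (n + 1)) L)) hwR
    set φ : MvPolynomial (Fin (n + 2)) L →+* Polynomial (FractionRing (MvPolynomial (Fin (n + 1)) L))
      := (Polynomial.mapRingHom (algebraMap _ _)).comp
        (MvPolynomial.finSuccEquiv L (n + 1)).toRingEquiv.toRingHom with hφ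
    have hφC : ∀ r, φ (MvPolynomial.C r) =
        Polynomial.C (algebraMap (MvPolynomial (Fin (n + 1)) L) _ (MvPolynomial.C r)) := by
      intro r; simp [hφ, MvPolynomial.finSuccEquiv_apply]
    have hφ0 : φ (MvPolynomial.X 0) = Polynomial.X := by
      simp [hφ, MvPolynomial.finSuccEquiv_X_zero]
    have hφs : ∀ j, φ (MvPolynomial.X (Fin.succ j)) =
        Polynomial.C (algebraMap (MvPolynomial (Fin (n + 1)) L) _ (MvPolynomial.X j)) := by
      intro j; simp [hφ, MvPolynomial.finSuccEquiv_X_succ]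
    have hφinj : Function.Injective φ :=
      (Polynomial.map_injective _ (IsFractionRing.injective _ _)).comp
        (MvPolynomial.finSuccEquiv L (n + 1)).injective
    have h2K : (2 : FractionRing (MvPolynomial (Fin (n + 1)) L)) ≠ 0 := by
      rw [← map_ofNat (algebraMap L _) 2]
      simpa using h2
    obtain ⟨y, hy0, hy⟩ := second_representation h2K hwK (Sum.inr 0)
      (algebraMap _ _ (∑ j : Fin n, MvPolynomial.C (c j.succ) * MvPolynomial.X j.castSucc ^ 2 +
        MvPolynomial.C a * MvPolynomial.X (Fin.last n) ^ 2)) (φ g) (fun i => φ (x i))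
      ((map_ne_zero_iff _ hφinj).2 hg) (by
        have h := congrArg φ hx
        simp only [map_sum, map_mul, map_pow, map_add, hφC, Fin.sum_univ_succ, Fin.castSucc_zero,
          hφ0, ← Fin.succ_castSucc, ← Fin.succ_last, hφs] at h
        rw [h]
        simp only [Sum.elim_inr, map_add, map_sum, map_mul, map_pow]
        ring)
    obtain ⟨g', y', hg', hy'⟩ :=
      exists_common_denominator (R := MvPolynomial (Fin (n + 1)) L) y
    refine ih (fun j => c j.succ) ?_ (fun i => y' (i.map id Fin.succ)) g' hg' ?_
    · intro z hz
      have := hw (Sum.elim (fun i => z (Sum.inl i)) (Fin.cons 0 fun j => z (Sum.inr j))) (by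
        simpa [Fin.sum_univ_succ] using hz)
      funext i
      cases i with
      | inl i => exact congrFun this (Sum.inl i)
      | inr j => exact congrFun this (Sum.inr j.succ)
    · apply IsFractionRing.injective _ (FractionRing (MvPolynomial (Fin (n + 1)) L))
      rw [map_mul, ← hy]
      simp [Fin.sum_univ_succ, hy0, hy']
      simp only [mul_pow, add_mul, Finset.sum_mul]
      congr 1 <;> exact Finset.sum_congr rfl fun i _ => by ring

lemma QuadraticMap.ext_of_map {F E ι : Type*} [CommRing F] [CommRing E] [Finite ι] (f : F →+* E)
    {q q' : QuadraticForm E (ι → E)} (h : ∀ v : ι → F, q (f ∘ v) = q' (f ∘ v)) : q = q' := by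
  classical
  let _ : LinearOrder ι := linearOrderOfSTO (WellOrderingRel)
  have hs : ∀ i, f ∘ (Pi.single i 1 : ι → F) = Pi.single i 1 := by
    intro i; funext j
    by_cases hij : j = i
    · subst hij; simp
    · simp [hij]
  have h1 : ∀ i, q (Pi.single i 1) = q' (Pi.single i 1) := fun i => by rw [← hs, h]
  have h2 : ∀ i j, polar q (Pi.single i 1) (Pi.single j 1) =
      polar q' (Pi.single i 1) (Pi.single j 1) := fun i j => by
    have hadd : (Pi.single i 1 + Pi.single j 1 : ι → E) =
        f ∘ (Pi.single i 1 + Pi.single j 1 : ι → F) := by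
      rw [← hs i, ← hs j]; funext k; simp
    simp only [polar, h1]
    rw [hadd, h]
  rw [← QuadraticMap.toQuadraticMap_toBilin q (Pi.basisFun E ι),
    ← QuadraticMap.toQuadraticMap_toBilin q' (Pi.basisFun E ι)]
  congr 1
  simp only [QuadraticMap.toBilin, Pi.basisFun_apply, h1, h2]

lemma QuadraticForm.mapAlong_apply {k E : Type*} [CommRing k] [CommRing E] (f : k →+* E) {n : ℕ}
    (q : QuadraticForm k (Fin n → k)) (x : Fin n → E) :
    q.mapAlong f x = ∑ i, ∑ j, x i * (if i = j then f (q (Pi.single i 1))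
      else if i < j then f (QuadraticMap.polar ⇑q (Pi.single i 1) (Pi.single j 1)) else 0) * x j := by
  change Matrix.toLinearMap₂' E _ x x = _
  rw [Matrix.toLinearMap₂'_apply]
  simp [mul_left_comm, mul_comm]

lemma QuadraticForm.mapAlong_comp_apply {k E K : Type*} [CommRing k] [CommRing E] [CommRing K]
    (f : k →+* E) (g : E →+* K) {n : ℕ} (q : QuadraticForm k (Fin n → k)) (x : Fin n → E) :
    q.mapAlong (g.comp f) (g ∘ x) = g (q.mapAlong f x) := by
  simp only [mapAlong_apply, map_sum, map_mul, apply_ite g, map_zero, Function.comp_apply,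
    RingHom.comp_apply]

lemma QuadraticForm.mapAlong_id {k : Type*} [CommRing k] {n : ℕ}
    (q : QuadraticForm k (Fin n → k)) : q.mapAlong (RingHom.id k) = q := by
  conv_rhs => rw [← QuadraticMap.toQuadraticMap_toBilin q (Pi.basisFun k (Fin n))]
  ext x
  rw [mapAlong_apply]
  simp only [QuadraticMap.toBilin, LinearMap.BilinMap.toQuadraticMap_apply,
    Module.Basis.constr_apply_fintype,
    LinearMap.sum_apply, LinearMap.smul_apply, Pi.basisFun_apply, Pi.basisFun_equivFun,
    LinearEquiv.refl_apply, smul_eq_mul, Finset.mul_sum, RingHom.id_apply]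
  exact Finset.sum_congr rfl fun i _ => Finset.sum_congr rfl fun j _ => by ring

lemma QuadraticForm.mapAlong_map {k E : Type*} [CommRing k] [CommRing E]
    (f : k →+* E) {n : ℕ} (q : QuadraticForm k (Fin n → k)) (x : Fin n → k) :
    q.mapAlong f (f ∘ x) = f (q x) := by
  have := mapAlong_comp_apply (RingHom.id k) f q x
  rwa [mapAlong_id, RingHom.comp_id] at this

/-- Extension of scalars of a linear map between coordinate spaces. -/
def LinearMap.extendScalarsAlong {F E ι κ : Type*} [CommRing F] [CommRing E] [Fintype ι]
    [DecidableEq ι] (f : F →+* E) (φ : (ι → F) →ₗ[F] (κ → F)) :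
    (ι → E) →ₗ[E] (κ → E) :=
  Matrix.toLin' ((LinearMap.toMatrix' φ).map f)

section
variable {F E K ι κ : Type*} [CommRing F] [CommRing E] [CommRing K] [Fintype ι] [DecidableEq ι]
  (f : F →+* E)

lemma LinearMap.extendScalarsAlong_comp_apply (g : E →+* K) (φ : (ι → F) →ₗ[F] (κ → F))
    (x : ι → E) : φ.extendScalarsAlong (g.comp f) (g ∘ x) = g ∘ φ.extendScalarsAlong f x := by
  funext k
  simp [extendScalarsAlong, Matrix.mulVec, dotProduct]

lemma LinearMap.extendScalarsAlong_map (φ : (ι → F) →ₗ[F] (κ → F)) (x : ι → F) :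
    φ.extendScalarsAlong f (f ∘ x) = f ∘ φ x := by
  funext k
  conv_rhs => rw [← LinearMap.toMatrix'_mulVec φ x, Function.comp_apply, Matrix.mulVec, dotProduct,
    map_sum]
  simp [extendScalarsAlong, Matrix.mulVec, dotProduct]

lemma LinearMap.extendScalarsAlong_leftInverse [Fintype κ] [DecidableEq κ]
    (φ : (ι → F) →ₗ[F] (κ → F)) (ψ : (κ → F) →ₗ[F] (ι → F)) (h : ψ ∘ₗ φ = LinearMap.id)
    (x : ι → E) : ψ.extendScalarsAlong f (φ.extendScalarsAlong f x) = x := by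
  rw [extendScalarsAlong, extendScalarsAlong, ← LinearMap.comp_apply, ← Matrix.toLin'_mul,
    ← Matrix.map_mul, ← LinearMap.toMatrix'_comp, h, LinearMap.toMatrix'_id]
  simp

lemma QuadraticMap.extendScalarsAlong [Finite κ] (φ : (ι → F) →ₗ[F] (κ → F))
    {q : QuadraticForm F (ι → F)} {q' : QuadraticForm F (κ → F)} (h : ∀ x, q' (φ x) = q x)
    {qE : QuadraticForm E (ι → E)} {qE' : QuadraticForm E (κ → E)}
    (hq : ∀ x, qE (f ∘ x) = f (q x)) (hq' : ∀ x, qE' (f ∘ x) = f (q' x)) (x : ι → E) :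
    qE' (φ.extendScalarsAlong f x) = qE x := by
  have : qE'.comp (φ.extendScalarsAlong f) = qE := by
    refine QuadraticMap.ext_of_map f fun v => ?_
    rw [QuadraticMap.comp_apply, LinearMap.extendScalarsAlong_map, hq', h, hq]
  exact congrArg (fun Q => Q x) this
end

/-- A quadratic form is *round* if each of its nonzero values is a similarity factor. -/
def QuadraticMap.IsRound {K V : Type*} [Field K] [AddCommGroup V] [Module K V]
    (q : QuadraticForm K V) : Prop :=
  ∀ y, q y ≠ 0 → ∃ φ : V →ₗ[K] V, ∀ x, q (φ x) = q y * q x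

lemma QuadraticMap.IsRound.exists_equiv {K V : Type*} [Field K] [AddCommGroup V] [Module K V]
    [FiniteDimensional K V] {q : QuadraticForm K V} (hq : q.IsRound) (han : q.Anisotropic)
    {y : V} (hy : q y ≠ 0) : ∃ φ : V ≃ₗ[K] V, ∀ x, q (φ x) = q y * q x := by
  obtain ⟨φ, hφ⟩ := hq y hy
  have hinj : Function.Injective φ := by
    rw [injective_iff_map_eq_zero]
    intro x hx
    have h := hφ x
    rw [hx, QuadraticMap.map_zero] at h
    exact han _ ((mul_eq_zero.1 h.symm).resolve_left hy)
  exact ⟨LinearEquiv.ofInjectiveEndo φ hinj, hφ⟩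

lemma QuadraticMap.IsRound.prod_smul {K V : Type*} [Field K] [AddCommGroup V] [Module K V]
    [FiniteDimensional K V] {q : QuadraticForm K V} (hq : q.IsRound) (han : q.Anisotropic) (b : K) :
    (q.prod (-b • q)).IsRound := by
  rintro ⟨y₁, y₂⟩ hy
  simp only [QuadraticMap.prod_apply, _root_.smul_apply, smul_eq_mul] at hy ⊢
  by_cases h₂ : q y₂ = 0
  · obtain ⟨φ, hφ⟩ := hq y₁ (by rintro h; simp [h, h₂] at hy)
    refine ⟨φ.prodMap φ, fun x => ?_⟩
    simp only [LinearMap.prodMap_apply, hφ, h₂]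
    ring
  obtain ⟨ψ, hψ⟩ := hq.exists_equiv han h₂
  by_cases h₁ : q y₁ = 0
  · refine ⟨LinearMap.prod (b • ψ.toLinearMap ∘ₗ LinearMap.snd K V V)
      (ψ.toLinearMap ∘ₗ LinearMap.fst K V V), fun x => ?_⟩
    simp [QuadraticMap.map_smul, hψ, h₁]
    ring
  obtain ⟨φ, hφ⟩ := hq.exists_equiv han h₁
  have hφs : ∀ x, q x = q y₁ * q (φ.symm x) := fun x => by rw [← hφ, φ.apply_symm_apply]
  have hadd : ∀ u v, q (u + v) = q u + q v + polar q u v := fun u v => by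
    simp [polar]
  have hpol : ∀ u v, polar q (φ u) (φ v) = q y₁ * polar q u v := fun u v => by
    simp only [polar, ← map_add, hφ]; ring
  have hpol' : ∀ u v, polar q (ψ u) (ψ v) = q y₂ * polar q u v := fun u v => by
    simp only [polar, ← map_add, hψ]; ring
  refine ⟨LinearMap.prod
    (φ.toLinearMap.coprod (b • ψ.toLinearMap))
    (ψ.toLinearMap.coprod ((q y₁ / q y₂) • (ψ.trans (φ.symm.trans ψ)).toLinearMap)), fun x => ?_⟩
  have hcross : polar q (φ x.1) (ψ x.2) = q y₁ * polar q x.1 (φ.symm (ψ x.2)) := by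
    rw [← hpol, φ.apply_symm_apply]
  have hval : q (φ.symm (ψ x.2)) = q y₂ / q y₁ * q x.2 := by
    have := hφs (ψ x.2)
    rw [hψ] at this
    field_simp
    linear_combination -this
  change q (φ x.1 + b • ψ x.2) + -b * q (ψ x.1 + (q y₁ / q y₂) • ψ (φ.symm (ψ x.2))) =
    (q y₁ + -b * q y₂) * (q x.1 + -b * q x.2)
  simp only [smul_eq_mul, hadd, QuadraticMap.map_smul, polar_smul_right, hφ, hψ, hcross, hpol',
    hval]
  field_simp
  ring

/-- Splitting the subsets of `Fin (n + 1)` according to whether they contain the last element. -/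
def Finset.finSuccEquivSum (n : ℕ) :
    Finset (Fin (n + 1)) ≃ Finset (Fin n) ⊕ Finset (Fin n) where
  toFun S := if Fin.last n ∈ S then Sum.inr (Finset.univ.filter fun i => i.castSucc ∈ S)
    else Sum.inl (Finset.univ.filter fun i => i.castSucc ∈ S)
  invFun := Sum.elim (fun S => S.map Fin.castSuccEmb)
    (fun S => insert (Fin.last n) (S.map Fin.castSuccEmb))
  left_inv S := by
    by_cases h : Fin.last n ∈ S
    · simp only [h, if_true, Sum.elim_inr]
      ext i
      induction i using Fin.lastCases <;> simp [h]
    · simp only [h, if_false, Sum.elim_inl]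
      ext i
      induction i using Fin.lastCases <;> simp [h]
  right_inv S := by
    rcases S with S | S <;> simp

/-- The vector space underlying an `(n + 1)`-fold Pfister form, as a product of two copies of the
space underlying an `n`-fold one. -/
def pfisterSplit (K : Type*) [Field K] (n : ℕ) :
    (Finset (Fin (n + 1)) → K) ≃ₗ[K] (Finset (Fin n) → K) × (Finset (Fin n) → K) :=
  (LinearEquiv.funCongrLeft K K (Finset.finSuccEquivSum n).symm).trans
    (LinearEquiv.sumArrowLequivProdArrow _ _ K K)

lemma PfisterForm_eq_prod {K : Type*} [Field K] {n : ℕ} (b : Fin (n + 1) → K)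
    (x : Finset (Fin (n + 1)) → K) :
    PfisterForm b x = (PfisterForm (Fin.init b)).prod
      (-b (Fin.last n) • PfisterForm (Fin.init b)) (pfisterSplit K n x) := by
  simp only [PfisterForm, QuadraticMap.prod_apply, _root_.smul_apply,
    QuadraticMap.weightedSumSquares_apply]
  rw [← (Finset.finSuccEquivSum n).symm.sum_comp, Fintype.sum_sum_type]
  congr 1
  · simp [Finset.finSuccEquivSum, pfisterSplit, Fin.init]
  · simp [Finset.finSuccEquivSum, pfisterSplit, Fin.init, Finset.mul_sum, mul_assoc]

lemma PfisterForm.isRound {K : Type*} [Field K] {n : ℕ} (b : Fin n → K)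
    (h : (PfisterForm b).Anisotropic) : (PfisterForm b).IsRound := by
  induction n with
  | zero =>
    intro y _
    refine ⟨y ∅ • LinearMap.id, fun x => ?_⟩
    have : ∀ x, PfisterForm b x = x ∅ * x ∅ := fun x => by
      rw [PfisterForm, QuadraticMap.weightedSumSquares_apply,
        Fintype.sum_eq_single ∅ fun S hS => absurd (Finset.eq_empty_of_isEmpty S) hS]
      simp
    simp only [LinearMap.smul_apply, LinearMap.id_apply, this, smul_eq_mul, Pi.smul_apply]
    ring
  | succ n ih =>
    have hinit : (PfisterForm (Fin.init b)).Anisotropic := by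
      intro x hx
      have h0 := h ((pfisterSplit K n).symm (x, 0)) (by
        rw [PfisterForm_eq_prod, LinearEquiv.apply_symm_apply]
        simp [hx])
      simpa using h0
    intro y hy
    rw [PfisterForm_eq_prod] at hy ⊢
    obtain ⟨φ, hφ⟩ := (ih _ hinit).prod_smul hinit (b (Fin.last n)) _ hy
    refine ⟨(pfisterSplit K n).symm.toLinearMap ∘ₗ φ ∘ₗ (pfisterSplit K n).toLinearMap,
      fun x => ?_⟩
    simp [PfisterForm_eq_prod b, -QuadraticMap.prod_apply, hφ]

/-- If `⟨⟨b_1, …, b_n, c⟩⟩` is isotropic and `⟨⟨b_1, …, b_n⟩⟩` is not, then the latter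
represents `c`. -/
lemma PfisterForm.exists_eq_of_isIsotropic_snoc {K : Type*} [Field K] {n : ℕ} (b : Fin n → K)
    (h : (PfisterForm b).Anisotropic) (c : K)
    (hc : (PfisterForm (Fin.snoc b c : Fin (n + 1) → K)).IsIsotropic) :
    ∃ z, PfisterForm b z = c := by
  obtain ⟨v, hv0, hv⟩ := hc
  rw [PfisterForm_eq_prod, Fin.init_snoc, Fin.snoc_last] at hv
  set z := pfisterSplit K n v with hz
  have hz0 : z ≠ 0 := by simpa [hz] using hv0
  simp only [QuadraticMap.prod_apply, _root_.smul_apply, smul_eq_mul] at hv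
  have h₂ : PfisterForm b z.2 ≠ 0 := by
    intro h0
    rw [h0, mul_zero, add_zero] at hv
    exact hz0 (Prod.ext (h _ hv) (h _ h0))
  obtain ⟨φ, hφ⟩ := PfisterForm.isRound b h z.2 h₂
  refine ⟨(PfisterForm b z.2)⁻¹ • φ z.1, ?_⟩
  rw [QuadraticMap.map_smul, hφ, smul_eq_mul]
  field_simp
  linear_combination hv

lemma PfisterForm.isIsotropic_snoc {K : Type*} [Field K] {n : ℕ} (b : Fin n → K)
    (z : Finset (Fin n) → K) :
    (PfisterForm (Fin.snoc b (PfisterForm b z) : Fin (n + 1) → K)).IsIsotropic := by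
  refine ⟨(pfisterSplit K n).symm (z, Pi.single ∅ 1), ?_, ?_⟩
  · simp
  · rw [PfisterForm_eq_prod, Fin.init_snoc, Fin.snoc_last, LinearEquiv.apply_symm_apply]
    have : PfisterForm b (Pi.single ∅ 1) = 1 := by
      simp [PfisterForm, QuadraticMap.weightedSumSquares_apply, Pi.single_apply]
    simp [this]

/-- Extension of scalars of a linear equivalence between coordinate spaces. -/
def LinearEquiv.extendScalarsAlong {F E ι κ : Type*} [CommRing F] [CommRing E] [Fintype ι]
    [DecidableEq ι] [Fintype κ] [DecidableEq κ] (f : F →+* E) (φ : (ι → F) ≃ₗ[F] (κ → F)) :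
    (ι → E) ≃ₗ[E] (κ → E) :=
  LinearEquiv.ofLinearMap (φ.toLinearMap.extendScalarsAlong f) (φ.symm.toLinearMap.extendScalarsAlong f)
    (LinearMap.ext fun x => LinearMap.extendScalarsAlong_leftInverse f _ _ (by ext; simp) x)
    (LinearMap.ext fun x => LinearMap.extendScalarsAlong_leftInverse f _ _ (by ext; simp) x)

lemma LinearEquiv.extendScalarsAlong_comp_apply {F E K ι κ : Type*} [CommRing F] [CommRing E]
    [CommRing K] [Fintype ι] [DecidableEq ι] [Fintype κ] [DecidableEq κ] (f : F →+* E) (g : E →+* K)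
    (φ : (ι → F) ≃ₗ[F] (κ → F)) (x : ι → E) :
    φ.extendScalarsAlong (g.comp f) (g ∘ x) = g ∘ φ.extendScalarsAlong f x :=
  LinearMap.extendScalarsAlong_comp_apply f g φ.toLinearMap x

lemma PfisterForm.map_apply {F E : Type*} [Field F] [Field E] (f : F →+* E) {n : ℕ} (b : Fin n → F)
    (x : Finset (Fin n) → F) : PfisterForm (fun i => f (b i)) (f ∘ x) = f (PfisterForm b x) := by
  simp [PfisterForm, QuadraticMap.weightedSumSquares_apply]

lemma PfisterForm.exists_equiv_mapAlong {F E : Type*} [Field F] [Field E] (f : F →+* E)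
    {t d₁ d₂ : ℕ} (b : Fin t → F)
    (u : QuadraticForm F (Fin d₁ → F)) (s : QuadraticForm F (Fin d₂ → F))
    (e : ((Fin d₁ → F) × (Fin d₂ → F)) ≃ₗ[F] (Finset (Fin t) → F))
    (he : ∀ v w, PfisterForm b (e (v, w)) = u v + s w) :
    ∃ θ : ((Fin d₁ → E) × (Fin d₂ → E)) ≃ₗ[E] (Finset (Fin t) → E),
      ∀ v w, PfisterForm (fun i => f (b i)) (θ (v, w)) = u.mapAlong f v + s.mapAlong f w := by
  set e' := (LinearEquiv.sumArrowLequivProdArrow (Fin d₁) (Fin d₂) F F).trans e with he'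
  refine ⟨(LinearEquiv.sumArrowLequivProdArrow (Fin d₁) (Fin d₂) E E).symm.trans
    (e'.extendScalarsAlong f), fun v w => ?_⟩
  have h := QuadraticMap.extendScalarsAlong f e'.toLinearMap
    (q := u.comp (LinearMap.funLeft F F Sum.inl) + s.comp (LinearMap.funLeft F F Sum.inr))
    (q' := PfisterForm b)
    (qE := (u.mapAlong f).comp (LinearMap.funLeft E E Sum.inl) +
      (s.mapAlong f).comp (LinearMap.funLeft E E Sum.inr))
    (qE' := PfisterForm fun i => f (b i))
    (fun x => by
      rw [he', LinearEquiv.coe_coe, LinearEquiv.trans_apply,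
        ← Prod.mk.eta (p := (LinearEquiv.sumArrowLequivProdArrow _ _ _ _ x)), he]
      rfl)
    (fun x => by
      simp only [_root_.add_apply, QuadraticMap.comp_apply, map_add,
        ← QuadraticForm.mapAlong_map]
      rfl)
    (PfisterForm.map_apply f b)
    ((LinearEquiv.sumArrowLequivProdArrow (Fin d₁) (Fin d₂) E E).symm (v, w))
  exact h

lemma QuadraticForm.exists_diagonalization {F : Type*} [Field F] (h2 : (2 : F) ≠ 0) {n : ℕ}
    (q : QuadraticForm F (Fin n → F)) :
    ∃ (w : Fin n → F) (φ : (Fin n → F) ≃ₗ[F] (Fin n → F)),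
      ∀ z, q (φ z) = ∑ i, w i * z i ^ 2 := by
  have : Invertible (2 : F) := invertibleOfNonzero h2
  have h := q.equivalent_weightedSumSquares
  rw [Module.finrank_fin_fun] at h
  obtain ⟨w, ⟨φ⟩⟩ := h
  refine ⟨w, φ.symm.toLinearEquiv, fun z => ?_⟩
  refine (φ.symm.map_app z).trans ?_
  simp [QuadraticMap.weightedSumSquares_apply, sq]

lemma QuadraticForm.mapAlong_diagonalization {F E : Type*} [CommRing F] [CommRing E] (f : F →+* E)
    {n : ℕ} {q : QuadraticForm F (Fin n → F)} {w : Fin n → F} {φ : (Fin n → F) ≃ₗ[F] (Fin n → F)}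
    (h : ∀ z, q (φ z) = ∑ i, w i * z i ^ 2) (x : Fin n → E) :
    q.mapAlong f (φ.extendScalarsAlong f x) = ∑ i, f (w i) * x i ^ 2 := by
  have := QuadraticMap.extendScalarsAlong f φ.toLinearMap
    (q := QuadraticMap.weightedSumSquares F w) (q' := q)
    (qE := QuadraticMap.weightedSumSquares E (f ∘ w)) (qE' := q.mapAlong f)
    (fun x => by simpa [QuadraticMap.weightedSumSquares_apply, sq] using h x)
    (fun x => by simp [QuadraticMap.weightedSumSquares_apply])
    (q.mapAlong_map f) x
  refine Eq.trans this ?_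
  simp [QuadraticMap.weightedSumSquares_apply, sq]

lemma QuadraticForm.mapAlong_prod_sq {F E : Type*} [CommRing F] [CommRing E] (f : F →+* E) {n : ℕ}
    (s : QuadraticForm F (Fin n → F)) (a : F) (x : Fin (n + 1) → E) :
    QuadraticForm.mapAlong f ((s.prod (a • QuadraticMap.sq)).comp
      (LinearMap.prod (LinearMap.funLeft F F Fin.castSucc) (LinearMap.proj (Fin.last n)))) x =
      s.mapAlong f (fun i => x i.castSucc) + f a * x (Fin.last n) ^ 2 := by
  have h : QuadraticForm.mapAlong f ((s.prod (a • QuadraticMap.sq)).comp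
      (LinearMap.prod (LinearMap.funLeft F F Fin.castSucc) (LinearMap.proj (Fin.last n)))) =
      ((s.mapAlong f).prod (f a • QuadraticMap.sq)).comp
      (LinearMap.prod (LinearMap.funLeft E E Fin.castSucc) (LinearMap.proj (Fin.last n))) := by
    refine QuadraticMap.ext_of_map f fun v => ?_
    rw [mapAlong_map]
    have : (LinearMap.funLeft E E Fin.castSucc) (f ∘ v) =
      f ∘ (LinearMap.funLeft F F Fin.castSucc) v := rfl
    simp [this, mapAlong_map]
  rw [h]
  simp [sq]
  rfl

lemma PfisterForm.anisotropic_fractionRing {L : Type*} [Field L] {t : ℕ} (b : Fin t → L)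
    (h : (PfisterForm b).Anisotropic) (n : ℕ) :
    (PfisterForm fun i => algebraMap (MvPolynomial (Fin n) L)
      (FractionRing (MvPolynomial (Fin n) L)) (MvPolynomial.C (b i))).Anisotropic := by
  have hw : ∀ x : Finset (Fin t) → L, ∑ S, (∏ i ∈ S, -b i) * x S ^ 2 = 0 → x = 0 := fun x hx =>
    h x (by simpa [PfisterForm, QuadraticMap.weightedSumSquares_apply, sq] using hx)
  intro x hx
  refine IsFractionRing.weighted_anisotropic (MvPolynomial.weighted_anisotropic hw n) x ?_
  simpa [PfisterForm, QuadraticMap.weightedSumSquares_apply, sq] using hx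

/-- If `s ⊥ ⟨a⟩` has its generic value represented by `u ⊥ s` over `L(X)`, and `u ⊥ s` is
anisotropic over `L`, then `u` represents a nonzero square multiple of `a` over `L`. -/
lemma exists_represents_of_genericValue {F L : Type*} [Field F] [Field L] (h2 : (2 : F) ≠ 0)
    (f : F →+* L) {d₁ d₂ : ℕ} (u : QuadraticForm F (Fin d₁ → F)) (s : QuadraticForm F (Fin d₂ → F))
    (a : F)
    (han : ∀ v w, u.mapAlong f v + s.mapAlong f w = 0 → v = 0 ∧ w = 0)
    {h : F →+* MvPolynomial (Fin (d₂ + 1)) L} (hh : h = MvPolynomial.C.comp f)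
    {g : F →+* FractionRing (MvPolynomial (Fin (d₂ + 1)) L)} (hg : g = (algebraMap _ _).comp h)
    (v : Fin d₁ → FractionRing (MvPolynomial (Fin (d₂ + 1)) L))
    (w : Fin d₂ → FractionRing (MvPolynomial (Fin (d₂ + 1)) L))
    (hvw : u.mapAlong g v + s.mapAlong g w =
      algebraMap (MvPolynomial (Fin (d₂ + 1)) L) _
        (s.mapAlong h (fun i => MvPolynomial.X i.castSucc) +
          h a * MvPolynomial.X (Fin.last d₂) ^ 2)) :
    ∃ (y : Fin d₁ → L) (τ : L), τ ≠ 0 ∧ u.mapAlong f y = f a * τ ^ 2 := by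
  obtain ⟨α, φ, hφ⟩ := u.exists_diagonalization h2
  obtain ⟨c, ψ, hψ⟩ := s.exists_diagonalization h2
  obtain ⟨v, rfl⟩ := (φ.extendScalarsAlong g).surjective v
  obtain ⟨w, rfl⟩ := (ψ.extendScalarsAlong g).surjective w
  rw [QuadraticForm.mapAlong_diagonalization g hφ, QuadraticForm.mapAlong_diagonalization g hψ]
    at hvw
  obtain ⟨G, y, hG, hy⟩ := exists_common_denominator (R := MvPolynomial (Fin (d₂ + 1)) L)
    (Sum.elim v w)
  have hR : ∑ i, h (Sum.elim α c i) * y i ^ 2 =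
      (s.mapAlong h (fun i => MvPolynomial.X i.castSucc) +
          h a * MvPolynomial.X (Fin.last d₂) ^ 2) * G ^ 2 := by
    apply IsFractionRing.injective _ (FractionRing (MvPolynomial (Fin (d₂ + 1)) L))
    rw [map_mul, ← hvw, Fintype.sum_sum_type]
    simp only [map_add, map_sum, map_mul, map_pow, hy, Sum.elim_inl, Sum.elim_inr,
      add_mul, Finset.sum_mul, hg, RingHom.comp_apply]
    congr 1 <;> exact Finset.sum_congr rfl fun i _ => by ring
  let subst (χ : (Fin d₂ → F) ≃ₗ[F] (Fin d₂ → F)) :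
      MvPolynomial (Fin (d₂ + 1)) L →+* MvPolynomial (Fin (d₂ + 1)) L :=
    MvPolynomial.eval₂Hom MvPolynomial.C (Fin.snoc
      (χ.extendScalarsAlong h fun i => MvPolynomial.X i.castSucc)
      (MvPolynomial.X (Fin.last d₂)) : Fin (d₂ + 1) → MvPolynomial (Fin (d₂ + 1)) L)
  have hsubst_h : ∀ χ, (subst χ).comp h = h := fun χ => by
    ext1 r
    rw [hh]
    exact MvPolynomial.eval₂Hom_C _ _ _
  have hsubst_X : ∀ χ, (subst χ) ∘ (fun i : Fin d₂ => MvPolynomial.X i.castSucc) =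
      χ.extendScalarsAlong h fun i => MvPolynomial.X i.castSucc := fun χ => by
    funext i; simp [subst]
  have hsubst_last : ∀ χ, subst χ (MvPolynomial.X (Fin.last d₂)) = MvPolynomial.X (Fin.last d₂) :=
    fun χ => by simp [subst]
  have hinv : (subst ψ.symm).comp (subst ψ) = RingHom.id _ := by
    refine MvPolynomial.ringHom_ext (fun r => by simp [subst]) fun i => ?_
    induction i using Fin.lastCases with
    | last => simp [hsubst_last]
    | cast i =>
      have h1 := LinearEquiv.extendScalarsAlong_comp_apply h (subst ψ.symm) ψ
        (fun i => MvPolynomial.X i.castSucc)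
      rw [hsubst_h, hsubst_X] at h1
      have h3 := congrFun (hsubst_X ψ) i
      have h4 := congrFun h1 i
      simp only [Function.comp_apply] at h3 h4
      rw [RingHom.comp_apply]
      refine (congrArg (subst ψ.symm) h3).trans (h4.symm.trans ?_)
      exact congrFun ((ψ.extendScalarsAlong h).apply_symm_apply _) i
  have hinj : Function.Injective (subst ψ) := by
    intro p q hpq
    simpa [hpq] using (DFunLike.congr_fun hinv p).symm.trans
      ((congrArg (subst ψ.symm) hpq).trans (DFunLike.congr_fun hinv q))
  have h2L : (2 : L) ≠ 0 := by
    rw [← map_ofNat f 2]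
    exact (map_ne_zero f).2 h2
  obtain ⟨z, τ, hτ, hz⟩ := weighted_descent h2L (fun i => f (α i)) (f a) d₂ (fun j => f (c j))
    (fun x hx => by
      simp only [Fintype.sum_sum_type, Sum.elim_inl, Sum.elim_inr] at hx
      have := han (φ.extendScalarsAlong f fun i => x (Sum.inl i))
        (ψ.extendScalarsAlong f fun i => x (Sum.inr i)) (by
          rw [QuadraticForm.mapAlong_diagonalization f hφ,
            QuadraticForm.mapAlong_diagonalization f hψ, hx])
      simp only [LinearEquiv.map_eq_zero_iff] at this
      funext i
      cases i with
      | inl i => exact congrFun this.1 i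
      | inr i => exact congrFun this.2 i)
    (fun i => subst ψ (y i)) (subst ψ G) ((map_ne_zero_iff _ hinj).2 hG) (by
      have hs : ∀ r, subst ψ (h r) = h r := fun r => RingHom.congr_fun (hsubst_h ψ) r
      have h1 := congrArg (subst ψ) hR
      have h3 := QuadraticForm.mapAlong_comp_apply h (subst ψ) s
        (fun i => MvPolynomial.X i.castSucc)
      rw [hsubst_h, hsubst_X, QuadraticForm.mapAlong_diagonalization h hψ] at h3
      simp only [map_sum, map_mul, map_pow, map_add, hs, hsubst_last] at h1
      refine Eq.trans ?_ (h1.trans ?_)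
      · refine Finset.sum_congr rfl fun i _ => ?_
        cases i <;> simp [hh]
      · congr 2
        · refine Eq.trans h3.symm ?_
          simp [hh]
        · simp [hh])
  refine ⟨φ.extendScalarsAlong f z, τ, hτ, ?_⟩
  rw [QuadraticForm.mapAlong_diagonalization f hφ, hz]

/-- **Induction step of the reduction to Pfister forms.** Let `π = ⟨⟨b_1, …, b_t⟩⟩` decompose
as `u ⊥ s`, let `a` be a unit, let `p = s ⊥ ⟨a⟩` (a form of rank `r = d₂ + 1`) with generic
value `p(X) ∈ F(X_1, …, X_r)`, and let `L/F` be an extension over which `π` stays anisotropic.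
Then `u ⊥ ⟨-a⟩` is isotropic over `L` iff `⟨⟨b_1, …, b_t, p(X)⟩⟩` is isotropic over
`L(X_1, …, X_r)`. -/
theorem reduction_induction_step {F : Type u} [Field F] (hF : ringChar F ≠ 2)
    {t d₁ d₂ : ℕ} (b : Fin t → F) (hb : ∀ i, b i ≠ 0) (hd : d₁ + d₂ = 2 ^ t)
    (u : QuadraticForm F (Fin d₁ → F)) (s : QuadraticForm F (Fin d₂ → F))
    (e : ((Fin d₁ → F) × (Fin d₂ → F)) ≃ₗ[F] (Finset (Fin t) → F))
    (he : ∀ v w, PfisterForm b (e (v, w)) = u v + s w)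
    (a : F) (ha : a ≠ 0)
    (L : Type u) [Field L] [Algebra F L]
    (hanis : (PfisterForm fun i => algebraMap F L (b i)).Anisotropic) :
    -- `p = s ⊥ ⟨a⟩`, as a quadratic form on `F^{d₂+1}`
    letI p : QuadraticForm F (Fin (d₂ + 1) → F) :=
      (s.prod (a • QuadraticMap.sq)).comp
        (LinearMap.prod (LinearMap.funLeft F F Fin.castSucc) (LinearMap.proj (Fin.last d₂)))
    (((u.mapAlong (algebraMap F L)).prod
        ((algebraMap F L (-a)) • QuadraticMap.sq)).IsIsotropic ↔
      (PfisterForm (Fin.snoc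
        (fun i => transMap F L (d₂ + 1) (toFrac F (d₂ + 1) (b i)))
        (transMap F L (d₂ + 1) (genericValue p)))).IsIsotropic) := by
  have h2 : (2 : F) ≠ 0 := Ring.two_ne_zero hF
  set f := algebraMap F L with hf
  set h : F →+* MvPolynomial (Fin (d₂ + 1)) L := MvPolynomial.C.comp f with hh
  set g : F →+* FractionRing (MvPolynomial (Fin (d₂ + 1)) L) := (algebraMap _ _).comp h with hg
  have htrans : ∀ p : MvPolynomial (Fin (d₂ + 1)) F,
      transMap F L (d₂ + 1) (algebraMap _ _ p) = algebraMap _ _ (MvPolynomial.map f p) := fun p =>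
    IsFractionRing.lift_algebraMap _ p
  have hcomp : (transMap F L (d₂ + 1)).comp (toFrac F (d₂ + 1)) = g := by
    ext r
    simp [toFrac, htrans, hg, hh]
  have hval : ∀ q : QuadraticForm F (Fin (d₂ + 1) → F), transMap F L (d₂ + 1) (genericValue q) =
      algebraMap (MvPolynomial (Fin (d₂ + 1)) L) _ (q.mapAlong h MvPolynomial.X) := fun q => by
    rw [genericValue, ← QuadraticForm.mapAlong_comp_apply, hcomp,
      ← QuadraticForm.mapAlong_comp_apply, ← hg]
    congr 1
    funext i
    simp [htrans]
  have hb' : (fun i => transMap F L (d₂ + 1) (toFrac F (d₂ + 1) (b i))) = fun i => g (b i) :=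
    funext fun i => RingHom.congr_fun hcomp (b i)
  rw [hval, hb', QuadraticForm.mapAlong_prod_sq]
  obtain ⟨θ, hθ⟩ := PfisterForm.exists_equiv_mapAlong f b u s e he
  obtain ⟨θ', hθ'⟩ := PfisterForm.exists_equiv_mapAlong g b u s e he
  have han : ∀ v w, u.mapAlong f v + s.mapAlong f w = 0 → v = 0 ∧ w = 0 := fun v w hvw => by
    have := hanis (θ (v, w)) (by rw [hθ, hvw])
    simpa using this
  constructor
  · rintro ⟨⟨v, τ⟩, hne, hv⟩
    simp only [QuadraticMap.prod_apply, _root_.smul_apply, QuadraticMap.sq_apply, smul_eq_mul,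
      map_neg] at hv
    have hτ : τ ≠ 0 := by
      rintro rfl
      have := (han v 0 (by simpa using hv)).1
      exact hne (by rw [this]; rfl)
    have hv' : u.mapAlong f (τ⁻¹ • v) = f a := by
      rw [QuadraticMap.map_smul, smul_eq_mul]
      field_simp
      linear_combination hv
    set X' : MvPolynomial (Fin (d₂ + 1)) L := MvPolynomial.X (Fin.last d₂)
    have huv : u.mapAlong g (algebraMap _ (FractionRing (MvPolynomial (Fin (d₂ + 1)) L)) X' •
        (algebraMap (MvPolynomial (Fin (d₂ + 1)) L) (FractionRing (MvPolynomial (Fin (d₂ + 1)) L)) ∘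
          MvPolynomial.C ∘ (τ⁻¹ • v))) = algebraMap _ _ (h a * X' ^ 2) := by
      rw [QuadraticMap.map_smul, hg, QuadraticForm.mapAlong_comp_apply, hh,
        QuadraticForm.mapAlong_comp_apply, hv']
      simp
      ring
    rw [map_add, ← huv, ← QuadraticForm.mapAlong_comp_apply, ← hg,
      add_comm (QuadraticForm.mapAlong g s _), ← hθ']
    exact PfisterForm.isIsotropic_snoc _ _
  · intro hiso
    obtain ⟨z, hz⟩ := PfisterForm.exists_eq_of_isIsotropic_snoc _
      (PfisterForm.anisotropic_fractionRing _ hanis (d₂ + 1)) _ hiso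
    obtain ⟨⟨v, w⟩, rfl⟩ := θ'.surjective z
    obtain ⟨y, τ, hτ, hy⟩ := exists_represents_of_genericValue h2 f u s a han hh hg v w
      ((hθ' v w).symm.trans hz)
    refine ⟨(y, τ), fun h0 => hτ (congrArg Prod.snd h0), ?_⟩
    simp [hy, sq]
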